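/- arXiv:1512.02950 — 3 statements merged into one kernel-verified Lean document; each statement's English description precedes it below -/
import Mathlib

section
/- Whitney decomposition with doubling small-boundary enlargements: Let Ω ⊂ ℝ^d be open, Ω ≠ ℝ^d. Then Ω can be decomposed as Ω = ∪_{i∈I} Q_i, where Q_i are closed dyadic cubes with disjoint interiors such that, for some constants R > 20 and D₀ ≥ 1 depending only on d: (i) 10Q_i ⊂ Ω for each i; (ii) R·Q_i ∩ Ω^c ≠ ∅ for each i; (iii) for each Q_i there are at most D₀ cubes Q_j with 10Q_i ∩ 10Q_j ≠ ∅, and for such pairs ℓ(Q_i) and ℓ(Q_j) are comparable with dimensional constants. Moreover, if μ is a positive Radon measure on ℝ^d with μ(Ω) < ∞ and C₁ is a big enough constant depending only on d, then there is a subfamily S ⊂ I and cubes Q̃_j with Q_j ⊂ Q̃_j ⊂ 1.1 Q_j for j ∈ S such that: (a) each Q̃_j is μ-(9, 2D₀)-doubling and has C₁-small boundary with respect to μ; (b) the cubes Q̃_j, j ∈ S, are pairwise disjoint; (c) μ(∪_{j∈S} Q̃_j) ≥ μ(Ω)/(8D₀). -/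
open MeasureTheory Metric Set ENNReal

noncomputable section

abbrev Pt (d : ℕ) := EuclideanSpace ℝ (Fin d)

structure Cube (d : ℕ) where
  center : Pt d
  side : ℝ

def Cube.toSet {d : ℕ} (Q : Cube d) : Set (Pt d) :=
  {x | ∀ i, |x i - Q.center i| ≤ Q.side / 2}

def Cube.scale {d : ℕ} (a : ℝ) (Q : Cube d) : Cube d := ⟨Q.center, a * Q.side⟩

def HasDegree {d : ℕ} (μ : Measure (Pt d)) (n C₀ : ℝ) : Prop :=
  ∀ (x : Pt d) (r : ℝ), 0 < r → μ (ball x r) ≤ ENNReal.ofReal (C₀ * r ^ n)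

structure IsCZKernel {d : ℕ} (K : Pt d → Pt d → ℂ) (n C α : ℝ) : Prop where
  size : ∀ x y : Pt d, x ≠ y → ‖K x y‖ ≤ C / dist x y ^ n
  smooth_fst : ∀ x x' y : Pt d, x ≠ y → 2 * dist x x' ≤ dist x y →
    ‖K x y - K x' y‖ ≤ C * dist x x' ^ α / dist x y ^ (n + α)
  smooth_snd : ∀ x y y' : Pt d, x ≠ y → 2 * dist y y' ≤ dist x y →
    ‖K x y - K x y'‖ ≤ C * dist y y' ^ α / dist x y ^ (n + α)

def truncT {d : ℕ} (μ : Measure (Pt d)) (K : Pt d → Pt d → ℂ) (ε : ℝ) (f : Pt d → ℂ)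
    (x : Pt d) : ℂ :=
  ∫ y in {y | ε < dist x y}, K x y * f y ∂μ

def maxT {d : ℕ} (μ : Measure (Pt d)) (K : Pt d → Pt d → ℂ) (δ : ℝ) (f : Pt d → ℂ)
    (x : Pt d) : ℝ≥0∞ :=
  ⨆ (ε : ℝ) (_ : δ < ε), (‖truncT μ K ε f x‖₊ : ℝ≥0∞)

def ballMax {d : ℕ} (μ : Measure (Pt d)) (f : Pt d → ℂ) (x : Pt d) : ℝ≥0∞ :=
  ⨆ (r : ℝ) (_ : 0 < r), (∫⁻ y in ball x r, ‖f y‖₊ ∂μ) / μ (ball x r)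

def cubeMax {d : ℕ} (μ : Measure (Pt d)) (p : ℝ) (f : Pt d → ℂ) (x : Pt d) : ℝ≥0∞ :=
  ⨆ (r : ℝ) (_ : 0 < r),
    ((∫⁻ y in (Cube.toSet ⟨x, 2 * r⟩), (‖f y‖₊ : ℝ≥0∞) ^ p ∂μ) / μ (Cube.toSet ⟨x, 2 * r⟩)) ^ (1 / p)

def IsAdmissible {d : ℕ} (μ : Measure (Pt d)) (Q : Cube d) (p B₁ : ℝ) (b : Pt d → ℂ) : Prop :=
  (∀ x ∉ Q.toSet, b x = 0) ∧
  (∫ x in Q.toSet, b x ∂μ = ((μ Q.toSet).toReal : ℂ)) ∧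
  (∫⁻ x in Q.toSet, (‖b x‖₊ : ℝ≥0∞) ^ p ∂μ ≤ ENNReal.ofReal B₁ * μ Q.toSet)

def IsDoubling {d : ℕ} (μ : Measure (Pt d)) (a b : ℝ) (Q : Cube d) : Prop :=
  μ (Cube.scale a Q).toSet ≤ ENNReal.ofReal b * μ Q.toSet

def SmallBoundary {d : ℕ} (μ : Measure (Pt d)) (t : ℝ) (Q : Cube d) : Prop :=
  ∀ lam : ℝ, 0 < lam →
    μ {x ∈ (Cube.scale 5 Q).toSet | infDist x (frontier Q.toSet) ≤ lam * Q.side}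
      ≤ ENNReal.ofReal (t * lam) * μ (Cube.scale 5 Q).toSet

def Cube.dyadicPiece {d : ℕ} (R : Cube d) (j : ℕ) (m : Fin d → Fin (2 ^ j)) : Cube d :=
  ⟨(WithLp.equiv 2 (Fin d → ℝ)).symm
      (fun i => R.center i - R.side / 2 + R.side / 2 ^ j * ((m i : ℝ) + 1 / 2)),
    R.side / 2 ^ j⟩

/-- A (closed) dyadic cube `2^{-k}([0,1)^d + m)`, `k ∈ ℤ`, `m ∈ ℤ^d`, described by its
center and side length. -/
def IsDyadicCube {d : ℕ} (P : Cube d) : Prop :=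
  ∃ (k : ℤ) (m : Fin d → ℤ),
    P.side = (2 : ℝ) ^ (-k) ∧ ∀ i, P.center i = (2 : ℝ) ^ (-k) * ((m i : ℝ) + 1 / 2)

def sd {d : ℕ} (x y : Pt d) : ℝ := dist (WithLp.ofLp x) (WithLp.ofLp y)

lemma sd_triangle {d : ℕ} (x y z : Pt d) : sd x z ≤ sd x y + sd y z := dist_triangle _ _ _
lemma sd_comm {d : ℕ} (x y : Pt d) : sd x y = sd y x := dist_comm _ _
lemma sd_self {d : ℕ} (x : Pt d) : sd x x = 0 := dist_self _
lemma sd_nonneg {d : ℕ} (x y : Pt d) : 0 ≤ sd x y := dist_nonneg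

lemma sd_le_iff {d : ℕ} (x y : Pt d) {r : ℝ} (hr : 0 ≤ r) :
    sd x y ≤ r ↔ ∀ i, |x i - y i| ≤ r := by
  unfold sd
  rw [dist_pi_le_iff hr]
  rfl

lemma sd_le_dist {d : ℕ} (x y : Pt d) : sd x y ≤ dist x y := by
  rw [sd_le_iff _ _ dist_nonneg]
  intro i
  rw [EuclideanSpace.dist_eq, ← Real.dist_eq]
  apply Real.le_sqrt_of_sq_le
  exact Finset.single_le_sum (f := fun i => dist (x.ofLp i) (y.ofLp i) ^ 2)
    (fun i _ => sq_nonneg _) (Finset.mem_univ i)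

lemma sd_continuous {d : ℕ} (y : Pt d) : Continuous (fun x : Pt d => sd x y) := by
  unfold sd
  fun_prop

lemma mem_toSet {d : ℕ} (Q : Cube d) (h : 0 ≤ Q.side) (x : Pt d) :
    x ∈ Q.toSet ↔ sd x Q.center ≤ Q.side / 2 := by
  rw [sd_le_iff _ _ (by linarith)]
  rfl

lemma mem_scale {d : ℕ} (Q : Cube d) (h : 0 ≤ Q.side) {a : ℝ} (ha : 0 ≤ a) (x : Pt d) :
    x ∈ (Cube.scale a Q).toSet ↔ sd x Q.center ≤ a * Q.side / 2 :=
  mem_toSet (Cube.scale a Q) (mul_nonneg ha h) x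

lemma scale_mono {d : ℕ} (Q : Cube d) (h : 0 ≤ Q.side) {a b : ℝ} (ha : 0 ≤ a) (hab : a ≤ b) :
    (Cube.scale a Q).toSet ⊆ (Cube.scale b Q).toSet := by
  intro x hx
  rw [mem_scale Q h ha] at hx
  rw [mem_scale Q h (ha.trans hab)]
  nlinarith

lemma scale_one_toSet {d : ℕ} (Q : Cube d) : (Cube.scale 1 Q).toSet = Q.toSet := by
  simp [Cube.scale]

lemma isClosed_toSet {d : ℕ} (Q : Cube d) : IsClosed Q.toSet := by
  have : Q.toSet = ⋂ i, {x : Pt d | |x i - Q.center i| ≤ Q.side / 2} := by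
    ext x; simp [Cube.toSet]
  rw [this]
  refine isClosed_iInter fun i => isClosed_le ?_ continuous_const
  fun_prop

lemma mem_interior_toSet {d : ℕ} (Q : Cube d) (h : 0 < Q.side) {x : Pt d}
    (hx : x ∈ interior Q.toSet) (i : Fin d) : |x i - Q.center i| < Q.side / 2 := by
  have e : Q.toSet = (EuclideanSpace.equiv (Fin d) ℝ).toHomeomorph ⁻¹'
      (closedBall (WithLp.ofLp Q.center) (Q.side / 2)) := by
    ext y
    rw [mem_toSet Q h.le]
    rfl
  rw [e, ← Homeomorph.preimage_interior, interior_closedBall _ (by linarith)] at hx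
  have hx' : dist (WithLp.ofLp x) (WithLp.ofLp Q.center) < Q.side / 2 := hx
  rw [dist_pi_lt_iff (by linarith)] at hx'
  exact hx' i

/-- dyadic cube of generation `k` containing `x` -/
def Qk {d : ℕ} (k : ℤ) (x : Pt d) : Cube d :=
  ⟨WithLp.toLp 2 fun i => (2 : ℝ) ^ (-k) * ((⌊(2 : ℝ) ^ k * x i⌋ : ℝ) + 1 / 2), (2 : ℝ) ^ (-k)⟩

lemma Qk_side_pos {d : ℕ} (k : ℤ) (x : Pt d) : 0 < (Qk k x).side := by
  unfold Qk; positivity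

lemma Qk_dist {d : ℕ} (k : ℤ) (x : Pt d) : sd x (Qk k x).center ≤ (2 : ℝ) ^ (-k) / 2 := by
  rw [sd_le_iff _ _ (by positivity)]
  intro i
  have h1 := Int.floor_le ((2 : ℝ) ^ k * x i)
  have h2 := Int.lt_floor_add_one ((2 : ℝ) ^ k * x i)
  have h3 : (0 : ℝ) < (2 : ℝ) ^ (-k) := by positivity
  have h4 : (2 : ℝ) ^ (-k) * ((2 : ℝ) ^ k * x i) = x i := by
    rw [← mul_assoc, ← zpow_add₀ (by norm_num)]; simp
  show |x i - (2 : ℝ) ^ (-k) * ((⌊(2 : ℝ) ^ k * x i⌋ : ℝ) + 1 / 2)| ≤ _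
  generalize (⌊(2 : ℝ) ^ k * x i⌋ : ℝ) = m at *
  have h5 := mul_le_mul_of_nonneg_left h1 h3.le
  have h6 := mul_le_mul_of_nonneg_left h2.le h3.le
  rw [h4] at h5 h6
  rw [abs_le]
  constructor <;> linarith

lemma Qk_floor_of_interior {d : ℕ} (k : ℤ) (x z : Pt d) (hz : z ∈ interior (Qk k x).toSet)
    (i : Fin d) : ⌊(2 : ℝ) ^ k * z i⌋ = ⌊(2 : ℝ) ^ k * x i⌋ := by
  have h := mem_interior_toSet _ (Qk_side_pos k x) hz i
  change |z i - (2 : ℝ) ^ (-k) * ((⌊(2 : ℝ) ^ k * x i⌋ : ℝ) + 1 / 2)| < (2 : ℝ) ^ (-k) / 2 at h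
  rw [Int.floor_eq_iff]
  generalize (⌊(2 : ℝ) ^ k * x i⌋ : ℝ) = m at *
  have h3 : (0 : ℝ) < (2 : ℝ) ^ k := by positivity
  have h4 : (2 : ℝ) ^ k * (2 : ℝ) ^ (-k) = 1 := by
    rw [← zpow_add₀ (by norm_num)]; simp
  generalize (2 : ℝ) ^ k = a at *
  generalize (2 : ℝ) ^ (-k) = b at *
  rw [abs_lt] at h
  have h5 := mul_lt_mul_of_pos_left h.1 h3
  have h6 := mul_lt_mul_of_pos_left h.2 h3
  have e1 : a * (z i - b * (m + 1 / 2)) = a * z i - (a * b) * (m + 1/2) := by ring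
  have e2 : a * (b / 2) = (a * b) / 2 := by ring
  have e3 : a * -(b / 2) = -((a * b) / 2) := by ring
  rw [e1, h4] at h5 h6
  rw [e3, h4] at h5
  rw [e2, h4] at h6
  constructor <;> linarith

lemma floor_coarse (x z : ℝ) (j k : ℤ) (hjk : j ≤ k)
    (h : ⌊(2 : ℝ) ^ k * z⌋ = ⌊(2 : ℝ) ^ k * x⌋) : ⌊(2 : ℝ) ^ j * z⌋ = ⌊(2 : ℝ) ^ j * x⌋ := by
  obtain ⟨n, rfl⟩ := Int.le.dest hjk
  have key : ∀ y : ℝ, (2 : ℝ) ^ j * y = (2 : ℝ) ^ (j + (n : ℤ)) * y / ((2 ^ n : ℕ) : ℝ) := by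
    intro y
    rw [zpow_add₀ (by norm_num)]
    push_cast
    rw [zpow_natCast]
    field_simp
  rw [key z, key x, Int.floor_div_natCast, Int.floor_div_natCast, h]

lemma Qk_congr {d : ℕ} (k : ℤ) (x z : Pt d)
    (h : ∀ i, ⌊(2 : ℝ) ^ k * z i⌋ = ⌊(2 : ℝ) ^ k * x i⌋) : Qk k z = Qk k x := by
  unfold Qk
  simp only [h]

lemma Qk_small {d : ℕ} (Ω : Set (Pt d)) (hΩ : IsOpen Ω) (x : Pt d) (hx : x ∈ Ω) :
    ∃ k : ℤ, (Cube.scale 20 (Qk k x)).toSet ⊆ Ω := by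
  have e : ∃ r > 0, ∀ y : Pt d, sd y x < r → y ∈ Ω := by
    let φ := (EuclideanSpace.equiv (Fin d) ℝ).toHomeomorph
    have ho : IsOpen (φ.symm ⁻¹' Ω) := hΩ.preimage φ.symm.continuous
    have hx' : φ x ∈ φ.symm ⁻¹' Ω := by simpa using hx
    obtain ⟨r, hr, h⟩ := Metric.isOpen_iff.1 ho _ hx'
    refine ⟨r, hr, fun y hy => ?_⟩
    have : φ y ∈ φ.symm ⁻¹' Ω := h hy
    simpa using this
  obtain ⟨r, hr, h⟩ := e
  obtain ⟨n, hn⟩ := exists_pow_lt_of_lt_one (show (0:ℝ) < r / 11 by positivity)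
    (show (1/2 : ℝ) < 1 by norm_num)
  refine ⟨n, fun y hy => h y ?_⟩
  rw [mem_scale _ (Qk_side_pos _ _).le (by norm_num)] at hy
  have h1 := Qk_dist (n : ℤ) x
  have h2 := sd_triangle y (Qk (n : ℤ) x).center x
  rw [sd_comm (Qk (n : ℤ) x).center x] at h2
  have h3 : (2 : ℝ) ^ (-(n : ℤ)) = (1 / 2) ^ n := by
    rw [zpow_neg, zpow_natCast]; simp
  have h4 : (Qk (n : ℤ) x).side = (2 : ℝ) ^ (-(n : ℤ)) := rfl
  rw [h4, h3] at hy
  rw [h3] at h1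
  linarith [pow_pos (show (0:ℝ) < 1/2 by norm_num) n]

lemma Qk_least {d : ℕ} (Ω : Set (Pt d)) (hΩ : IsOpen Ω) (hne : Ω ≠ univ) (x : Pt d) (hx : x ∈ Ω) :
    ∃ k : ℤ, (Cube.scale 20 (Qk k x)).toSet ⊆ Ω ∧
      ∀ j, (Cube.scale 20 (Qk j x)).toSet ⊆ Ω → k ≤ j := by
  classical
  obtain ⟨y, hy⟩ := (ne_univ_iff_exists_notMem Ω).1 hne
  obtain ⟨n, hn⟩ := pow_unbounded_of_one_lt (sd y x) (show (1 : ℝ) < 2 by norm_num)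
  apply Int.exists_least_of_bdd
    (P := fun k => (Cube.scale 20 (Qk k x)).toSet ⊆ Ω) ⟨-n, fun z hz => ?_⟩
      (Qk_small Ω hΩ x hx)
  · by_contra! hlt
    apply hy
    apply hz
    rw [mem_scale _ (Qk_side_pos _ _).le (by norm_num)]
    have h4 : (Qk z x).side = (2 : ℝ) ^ (-z) := rfl
    have h1 := Qk_dist z x
    have h2 := sd_triangle y x (Qk z x).center
    have h3 : (2 : ℝ) ^ n ≤ (2 : ℝ) ^ (-z) := by
      rw [← zpow_natCast]
      exact zpow_le_zpow_right₀ (by norm_num) (by omega)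
    rw [h4]
    have : (0 : ℝ) < (2 : ℝ) ^ (-z) := by positivity
    linarith

lemma whitney_family {d : ℕ} (Ω : Set (Pt d)) (hΩ : IsOpen Ω) (hne : Ω ≠ univ) :
    ∃ F : Set (Cube d), F.Countable ∧ (∀ P ∈ F, IsDyadicCube P) ∧
          (⋃ P ∈ F, P.toSet) = Ω ∧
          (∀ P ∈ F, ∀ P' ∈ F, P ≠ P' →
            interior P.toSet ∩ interior P'.toSet = ∅) ∧
          (∀ P ∈ F, (Cube.scale 20 P).toSet ⊆ Ω) ∧
          (∀ P ∈ F, ((Cube.scale 43 P).toSet ∩ Ωᶜ).Nonempty) := by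
  have key := fun x : Ω => Qk_least Ω hΩ hne x.1 x.2
  choose k hk1 hk2 using key
  refine ⟨range fun x : Ω => Qk (k x) x.1, ?_, ?_, ?_, ?_, ?_, ?_⟩
  · have : range (fun x : Ω => Qk (k x) x.1) ⊆ range (fun p : ℤ × (Fin d → ℤ) =>
        (⟨WithLp.toLp 2 fun i => (2 : ℝ) ^ (-p.1) * ((p.2 i : ℝ) + 1 / 2),
          (2 : ℝ) ^ (-p.1)⟩ : Cube d)) := by
      rintro _ ⟨x, rfl⟩
      exact ⟨(k x, fun i => ⌊(2 : ℝ) ^ (k x) * x.1 i⌋), rfl⟩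
    exact (countable_range _).mono this
  · rintro _ ⟨x, rfl⟩
    exact ⟨k x, fun i => ⌊(2 : ℝ) ^ (k x) * x.1 i⌋, rfl, fun i => rfl⟩
  · apply subset_antisymm
    · refine iUnion₂_subset ?_
      rintro _ ⟨x, rfl⟩
      refine Subset.trans ?_ (hk1 x)
      rw [← scale_one_toSet]
      exact scale_mono _ (Qk_side_pos _ _).le (by norm_num) (by norm_num)
    · intro x hx
      rw [mem_iUnion₂]
      refine ⟨_, ⟨⟨x, hx⟩, rfl⟩, ?_⟩
      rw [mem_toSet _ (Qk_side_pos _ _).le]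
      exact Qk_dist _ _
  · have aux : ∀ x y : Ω, ∀ z, z ∈ interior (Qk (k x) x.1).toSet →
        z ∈ interior (Qk (k y) y.1).toSet → k y ≤ k x := by
      intro x y z hx hy
      by_contra! hlt
      have h1 := Qk_floor_of_interior _ _ _ hx
      have h2 := Qk_floor_of_interior _ _ _ hy
      have h3 : Qk (k x) z = Qk (k x) x.1 := Qk_congr _ _ _ h1
      have h4 : Qk (k x) z = Qk (k x) y.1 :=
        Qk_congr _ _ _ fun i => floor_coarse _ _ _ _ hlt.le (h2 i)
      have := hk2 y (k x) (by rw [← h4, h3]; exact hk1 x)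
      omega
    rintro _ ⟨x, rfl⟩ _ ⟨y, rfl⟩ hxy
    by_contra hcon
    obtain ⟨z, hx, hy⟩ := nonempty_iff_ne_empty.2 hcon
    apply hxy
    have e := le_antisymm (aux _ _ z hy hx) (aux _ _ z hx hy)
    have h1 := Qk_congr _ _ _ (Qk_floor_of_interior _ _ _ hx)
    have h2 := Qk_congr _ _ _ (Qk_floor_of_interior _ _ _ hy)
    show Qk (k x) x.1 = Qk (k y) y.1
    rw [← h1, ← h2, e]
  · rintro _ ⟨x, rfl⟩
    exact hk1 x
  · rintro _ ⟨x, rfl⟩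
    have hn : ¬ (Cube.scale 20 (Qk (k x - 1) x.1)).toSet ⊆ Ω := by
      intro h
      have := hk2 x _ h
      omega
    obtain ⟨y, hy, hyΩ⟩ := not_subset.1 hn
    refine ⟨y, ?_, hyΩ⟩
    rw [mem_scale _ (Qk_side_pos _ _).le (by norm_num)] at hy ⊢
    have h1 := Qk_dist (k x) x.1
    have h2 := Qk_dist (k x - 1) x.1
    have h3 := sd_triangle y (Qk (k x - 1) x.1).center x.1
    have h4 := sd_triangle y x.1 (Qk (k x) x.1).center
    rw [sd_comm (Qk (k x - 1) x.1).center x.1] at h3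
    have e1 : (Qk (k x) x.1).side = (2 : ℝ) ^ (-(k x)) := rfl
    have e2 : (Qk (k x - 1) x.1).side = (2 : ℝ) ^ (-(k x - 1)) := rfl
    have e3 : (2 : ℝ) ^ (-(k x - 1)) = 2 * (2 : ℝ) ^ (-(k x)) := by
      rw [show -(k x - 1) = 1 + -(k x) by ring, zpow_add₀ (by norm_num)]; simp
    rw [e2, e3] at hy
    rw [e3] at h2
    rw [e1]
    linarith

lemma maximal_pt (ν : Measure ℝ) (M : ℝ≥0∞) (hM : ν univ ≤ M) (hfin : M < ∞) :
    ∃ t ∈ Icc (1 : ℝ) 1.1, ∀ s : ℝ, 0 < s → ν (closedBall t s) ≤ ENNReal.ofReal (200 * s) * M := by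
  by_contra! hcon
  choose! s hs0 hs using hcon
  have hM0 : M ≠ 0 := by
    rintro rfl
    have h := hs 1 (by norm_num)
    have : ν (closedBall 1 (s 1)) ≤ 0 := (measure_mono (subset_univ _)).trans hM
    simp at h
    simp at this
    exact h.ne' this
  obtain ⟨u, hu, hdis, hcov⟩ := Vitali.exists_disjoint_subfamily_covering_enlargement_closedBall
    (Icc (1 : ℝ) 1.1) (fun t => t) s 1 (fun t ht => by
      by_contra! hlt
      have h1 := hs t ht
      have h2 : ν (closedBall t (s t)) ≤ M := (measure_mono (subset_univ _)).trans hM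
      have h3 : (1 : ℝ≥0∞) ≤ ENNReal.ofReal (200 * s t) := by
        rw [ENNReal.one_le_ofReal]; linarith
      have h4 : M ≤ ENNReal.ofReal (200 * s t) * M := by
        calc M = 1 * M := (one_mul _).symm
          _ ≤ _ := by gcongr
      exact absurd h1 (not_lt.2 (h2.trans h4))) 4 (by norm_num)
  have hcount : u.Countable := by
    refine hdis.countable_of_nonempty_interior fun t ht => ?_
    rw [interior_closedBall _ (hs0 t (hu ht)).ne']
    exact nonempty_ball.2 (hs0 t (hu ht))
  have h1 : volume (Icc (1 : ℝ) 1.1) ≤ ∑' t : u, volume (closedBall (t : ℝ) (4 * s t)) := by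
    refine (measure_mono ?_).trans
      (measure_biUnion_le volume hcount (fun t : ℝ => closedBall t (4 * s t)))
    intro t ht
    obtain ⟨b, hb, hsub⟩ := hcov t ht
    exact mem_iUnion₂.2 ⟨b, hb, hsub (mem_closedBall_self (hs0 t ht).le)⟩
  have h2 : ∑' t : u, ν (closedBall (t : ℝ) (s t)) ≤ M := by
    rw [← measure_biUnion hcount hdis (fun _ _ => isClosed_closedBall.measurableSet)]
    exact (measure_mono (subset_univ _)).trans hM
  have h3 : ∀ t : u, volume (closedBall (t : ℝ) (4 * s t)) * M ≤
      ENNReal.ofReal (8/200) * ν (closedBall (t : ℝ) (s t)) := by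
    intro t
    have h5 : (0:ℝ) < s t := hs0 t (hu t.2)
    calc volume (closedBall (t : ℝ) (4 * s t)) * M
        = ENNReal.ofReal (8 / 200) * (ENNReal.ofReal (200 * s t) * M) := by
          rw [Real.volume_closedBall, ← mul_assoc (ENNReal.ofReal (8 / 200)),
            ← ENNReal.ofReal_mul (by norm_num)]
          congr 2; ring
      _ ≤ _ := by gcongr; exact (hs t (hu t.2)).le
  have h4 : ENNReal.ofReal (1 / 10) * M ≤ ENNReal.ofReal (8 / 200) * M := by
    calc ENNReal.ofReal (1 / 10) * M = volume (Icc (1 : ℝ) 1.1) * M := by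
          rw [Real.volume_Icc]; congr 2; norm_num
      _ ≤ (∑' t : u, volume (closedBall (t : ℝ) (4 * s t))) * M := by gcongr
      _ = ∑' t : u, volume (closedBall (t : ℝ) (4 * s t)) * M := ENNReal.tsum_mul_right.symm
      _ ≤ ∑' t : u, ENNReal.ofReal (8/200) * ν (closedBall (t : ℝ) (s t)) :=
          ENNReal.tsum_le_tsum h3
      _ = ENNReal.ofReal (8/200) * ∑' t : u, ν (closedBall (t : ℝ) (s t)) := ENNReal.tsum_mul_left
      _ ≤ _ := by gcongr
  rw [ENNReal.mul_le_mul_iff_left hM0 hfin.ne] at h4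
  rw [ENNReal.ofReal_le_ofReal_iff (by norm_num)] at h4
  norm_num at h4

lemma frontier_toSet_nonempty {d : ℕ} (hd : 0 < d) (Q : Cube d) (h : 0 < Q.side) :
    (frontier Q.toSet).Nonempty := by
  rw [nonempty_frontier_iff]
  refine ⟨⟨Q.center, ?_⟩, ?_⟩
  · rw [mem_toSet Q h.le, sd_self]; linarith
  · rw [ne_univ_iff_exists_notMem]
    refine ⟨WithLp.toLp 2 fun i => Q.center i + Q.side, fun hm => ?_⟩
    have := hm ⟨0, hd⟩
    simp [abs_of_pos h] at this
    linarith

lemma frontier_sd {d : ℕ} (Q : Cube d) (h : 0 < Q.side) {y : Pt d} (hy : y ∈ frontier Q.toSet) :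
    sd y Q.center = Q.side / 2 := by
  have e : Q.toSet = {x | sd x Q.center ≤ Q.side / 2} := by
    ext x; exact mem_toSet Q h.le x
  rw [e] at hy
  exact frontier_le_subset_eq (sd_continuous _) continuous_const hy

lemma exists_small_boundary {d : ℕ} (hd : 0 < d) (μ : Measure (Pt d)) (P : Cube d)
    (hP : 0 < P.side) (hfin : μ (Cube.scale 10 P).toSet < ∞) :
    ∃ t ∈ Icc (1 : ℝ) 1.1, SmallBoundary μ 500 (Cube.scale t P) := by
  set ρ : Pt d → ℝ := fun x => sd x P.center / (P.side / 2) with hρ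
  have hρc : Continuous ρ := (sd_continuous _).div_const _
  have hM : μ (Cube.scale 5 P).toSet < ∞ :=
    (measure_mono (scale_mono P hP.le (by norm_num) (by norm_num))).trans_lt hfin
  obtain ⟨t, ht, H⟩ := maximal_pt ((μ.restrict (Cube.scale 5 P).toSet).map ρ)
    (μ (Cube.scale 5 P).toSet) (by
      rw [Measure.map_apply hρc.measurable MeasurableSet.univ]; simp) hM
  refine ⟨t, ht, fun lam hlam => ?_⟩
  have ht0 : 0 < t := by linarith [ht.1]
  have ht2 : t ≤ 1.1 := ht.2
  set Q := Cube.scale t P with hQ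
  have hQs : Q.side = t * P.side := rfl
  have hQc : Q.center = P.center := rfl
  have hQ0 : 0 < Q.side := by rw [hQs]; positivity
  rcases le_or_gt (1 / 2) lam with hl | hl
  · calc _ ≤ μ (Cube.scale 5 Q).toSet := measure_mono (sep_subset _ _)
      _ = 1 * μ (Cube.scale 5 Q).toSet := (one_mul _).symm
      _ ≤ _ := by
        gcongr
        rw [ENNReal.one_le_ofReal]; linarith
  · have hmono : (Cube.scale 5 P).toSet ⊆ (Cube.scale 5 Q).toSet := by
      intro x hx
      rw [mem_scale P hP.le (by norm_num)] at hx
      rw [mem_scale Q hQ0.le (by norm_num), hQc, hQs]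
      nlinarith [ht.1]
    calc _ ≤ μ (ρ ⁻¹' (closedBall t (2 * lam * t)) ∩ (Cube.scale 5 P).toSet) := by
          apply measure_mono
          rintro x ⟨-, hx⟩
          obtain ⟨y, hy, hxy⟩ := isClosed_frontier.exists_infDist_eq_dist
            (frontier_toSet_nonempty hd Q hQ0) x
          rw [hxy] at hx
          have h1 := frontier_sd Q hQ0 hy
          have h2 := (sd_le_dist x y).trans hx
          have h3 := sd_triangle x y Q.center
          have h4 := sd_triangle y x Q.center
          rw [sd_comm y x] at h4
          rw [h1] at h3 h4
          rw [hQs, hQc] at *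
          have h5 : |sd x P.center - t * P.side / 2| ≤ lam * (t * P.side) := by
            rw [abs_le]; constructor <;> linarith
          have h6 : |ρ x - t| ≤ 2 * lam * t := by
            have : ρ x - t = (sd x P.center - t * P.side / 2) / (P.side / 2) := by
              rw [hρ]; field_simp
            rw [this, abs_div, abs_of_pos (show 0 < P.side / 2 by linarith),
              div_le_iff₀ (by linarith)]
            linarith
          refine ⟨by rw [mem_preimage, mem_closedBall, Real.dist_eq]; exact h6, ?_⟩
          rw [mem_scale P hP.le (by norm_num)]
          have h7 : lam * (t * P.side) ≤ 1 / 2 * (1.1 * P.side) := by gcongr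
          have h8 : t * P.side ≤ 1.1 * P.side := by gcongr
          linarith
      _ ≤ ENNReal.ofReal (200 * (2 * lam * t)) * μ (Cube.scale 5 P).toSet := by
          have := H (2 * lam * t) (by positivity)
          rwa [Measure.map_apply hρc.measurable isClosed_closedBall.measurableSet,
            Measure.restrict_apply (hρc.measurable isClosed_closedBall.measurableSet)] at this
      _ ≤ _ := by
          have : 200 * (2 * lam * t) ≤ 500 * lam := by nlinarith
          gcongr

lemma side_cmp {d : ℕ} {Ω : Set (Pt d)} (P P' : Cube d) (h : 0 < P.side) (h' : 0 < P'.side)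
    (h20 : (Cube.scale 20 P).toSet ⊆ Ω) (h43 : ((Cube.scale 43 P').toSet ∩ Ωᶜ).Nonempty)
    (hn : ((Cube.scale 10 P).toSet ∩ (Cube.scale 10 P').toSet).Nonempty) :
    P.side ≤ 5.3 * P'.side := by
  obtain ⟨z, hz, hz'⟩ := hn
  obtain ⟨w, hw, hwΩ⟩ := h43
  have hw2 : w ∉ (Cube.scale 20 P).toSet := fun hh => hwΩ (h20 hh)
  rw [mem_scale _ h.le (by norm_num)] at hz hw2
  rw [mem_scale _ h'.le (by norm_num)] at hz' hw
  have h1 := sd_triangle w z P.center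
  have h2 := sd_triangle w P'.center z
  rw [sd_comm P'.center z] at h2
  push Not at hw2
  linarith

open Classical in
def col {d : ℕ} (P : Cube d) : ZMod 5 × (Fin d → ZMod 64) :=
  if h : IsDyadicCube P then ((h.choose : ℤ), fun i => ((h.choose_spec.choose i : ℤ) : ZMod 64))
  else 0

lemma col_spec {d : ℕ} (P : Cube d) (h : IsDyadicCube P) :
    ∃ (k : ℤ) (m : Fin d → ℤ), P.side = (2 : ℝ) ^ (-k) ∧
      (∀ i, P.center i = (2 : ℝ) ^ (-k) * ((m i : ℝ) + 1 / 2)) ∧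
      col P = ((k : ZMod 5), fun i => (m i : ZMod 64)) := by
  refine ⟨h.choose, h.choose_spec.choose, h.choose_spec.choose_spec.1,
    h.choose_spec.choose_spec.2, ?_⟩
  unfold col
  rw [dif_pos h]

lemma side_pos {d : ℕ} {P : Cube d} (h : IsDyadicCube P) : 0 < P.side := by
  obtain ⟨k, m, h, -⟩ := h
  rw [h]; positivity

lemma exp_lt (k k' : ℤ) (h : (2 : ℝ) ^ (-k) < 32 * (2 : ℝ) ^ (-k')) : k' < k + 5 := by
  have e : (32 : ℝ) * (2 : ℝ) ^ (-k') = (2 : ℝ) ^ (5 + -k') := by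
    rw [zpow_add₀ (by norm_num)]; norm_num
  rw [e, zpow_lt_zpow_iff_right₀ (by norm_num)] at h
  omega

lemma col_inj {d : ℕ} (P₀ P P' : Cube d) (h₀ : 0 < P₀.side) (h : IsDyadicCube P)
    (h' : IsDyadicCube P')
    (hn : ((Cube.scale 10 P₀).toSet ∩ (Cube.scale 10 P).toSet).Nonempty)
    (hn' : ((Cube.scale 10 P₀).toSet ∩ (Cube.scale 10 P').toSet).Nonempty)
    (c1 : P.side ≤ 5.3 * P₀.side) (c2 : P₀.side ≤ 5.3 * P.side)
    (c1' : P'.side ≤ 5.3 * P₀.side) (c2' : P₀.side ≤ 5.3 * P'.side)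
    (hc : col P = col P') : P = P' := by
  have hp := side_pos h
  have hp' := side_pos h'
  obtain ⟨k, m, hs, hcen, hcol⟩ := col_spec P h
  obtain ⟨k', m', hs', hcen', hcol'⟩ := col_spec P' h'
  rw [hcol, hcol', Prod.mk.injEq] at hc
  obtain ⟨hk, hm⟩ := hc
  have hk1 : k' < k + 5 := exp_lt _ _ (by rw [← hs, ← hs']; linarith)
  have hk2 : k < k' + 5 := exp_lt _ _ (by rw [← hs, ← hs']; linarith)
  have hkk : k = k' := by
    rw [ZMod.intCast_eq_intCast_iff_dvd_sub] at hk
    push_cast at hk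
    omega
  subst hkk
  obtain ⟨z, hz, hz2⟩ := hn
  obtain ⟨w, hw, hw2⟩ := hn'
  rw [mem_scale _ h₀.le (by norm_num)] at hz hw
  rw [mem_scale _ hp.le (by norm_num)] at hz2
  rw [mem_scale _ hp'.le (by norm_num)] at hw2
  have t1 := sd_triangle P.center z P₀.center
  have t2 := sd_triangle P₀.center w P'.center
  have t3 := sd_triangle P.center P₀.center P'.center
  rw [sd_comm P.center z] at t1
  rw [sd_comm P₀.center w] at t2
  have hss : P'.side = P.side := by rw [hs, hs']
  have hd : sd P.center P'.center ≤ 63 * P.side := by linarith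
  rw [sd_le_iff _ _ (by positivity)] at hd
  have hmm : m = m' := by
    funext i
    have e := congrFun hm i
    rw [ZMod.intCast_eq_intCast_iff_dvd_sub] at e
    push_cast at e
    have hi := hd i
    rw [hcen i, hcen' i, hs, ← mul_sub, abs_mul, abs_of_pos (by positivity), mul_comm] at hi
    have hi2 := le_of_mul_le_mul_right hi (show (0:ℝ) < (2 : ℝ) ^ (-k) by positivity)
    have hi3 : |m i - m' i| ≤ (63 : ℤ) := by
      have : ((m i : ℝ) + 1 / 2 - ((m' i : ℝ) + 1 / 2)) = ((m i - m' i : ℤ) : ℝ) := by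
        push_cast; ring
      rw [this] at hi2
      rw [← Int.cast_abs] at hi2
      have hi4 : ((|m i - m' i| : ℤ) : ℝ) ≤ ((63 : ℤ) : ℝ) := by
        rw [show ((63 : ℤ) : ℝ) = 63 by norm_num]
        exact hi2
      exact Int.cast_le.1 hi4
    rw [abs_le] at hi3
    omega
  subst hmm
  cases P with
  | mk c s =>
    cases P' with
    | mk c' s' =>
      simp only at hss hcen hcen'
      subst hss
      have : c = c' := by
        ext i
        rw [hcen i, hcen' i]
      rw [this]

lemma mass {d : ℕ} {κ : Type} [Fintype κ] [Nonempty κ] (col : Cube d → κ) (Ω : Set (Pt d))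
    (F : Set (Cube d)) (hF : F.Countable) (hU : (⋃ P ∈ F, P.toSet) = Ω)
    (h10 : ∀ P ∈ F, (Cube.scale 10 P).toSet ⊆ Ω)
    (hcol : ∀ P ∈ F, ∀ P' ∈ F, col P = col P' →
      ((Cube.scale 10 P).toSet ∩ (Cube.scale 10 P').toSet).Nonempty → P = P')
    (μ : Measure (Pt d)) (hμ : μ Ω < ∞) :
    ∃ S ⊆ F, (∀ P ∈ S, μ (Cube.scale 10 P).toSet ≤ (2 * (Fintype.card κ : ℝ≥0∞)) * μ P.toSet) ∧
      (∀ P ∈ S, ∀ P' ∈ S, P ≠ P' →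
        Disjoint (Cube.scale 10 P).toSet (Cube.scale 10 P').toSet) ∧
      μ Ω ≤ (2 * (Fintype.card κ : ℝ≥0∞)) * μ (⋃ P ∈ S, P.toSet) := by
  set D : ℝ≥0∞ := (Fintype.card κ : ℝ≥0∞) with hD
  have hD0 : D ≠ 0 := by simp [hD]
  have hDt : D ≠ ∞ := by simp [hD]
  set G : Set (Cube d) := {P ∈ F | μ (Cube.scale 10 P).toSet ≤ (2 * D) * μ P.toSet} with hG
  set B : Set (Cube d) := {P ∈ F | ¬ μ (Cube.scale 10 P).toSet ≤ (2 * D) * μ P.toSet} with hB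
  have hsplit : ∀ A : Set (Cube d), μ (⋃ P ∈ A, P.toSet) ≤
      ∑ c, μ (⋃ P ∈ {P ∈ A | col P = c}, P.toSet) := by
    intro A
    refine (measure_mono ?_).trans (measure_iUnion_fintype_le μ
      (fun c => ⋃ P ∈ {P ∈ A | col P = c}, P.toSet))
    refine iUnion₂_subset fun P hP => ?_
    intro x hx
    exact mem_iUnion.2 ⟨col P, mem_iUnion₂.2 ⟨P, ⟨hP, rfl⟩, hx⟩⟩
  have hBc : ∀ c, (2 * D) * μ (⋃ P ∈ {P ∈ B | col P = c}, P.toSet) ≤ μ Ω := by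
    intro c
    have hcnt : {P ∈ B | col P = c}.Countable := hF.mono fun P hP => hP.1.1
    calc (2 * D) * μ (⋃ P ∈ {P ∈ B | col P = c}, P.toSet)
        ≤ (2 * D) * ∑' P : {P ∈ B | col P = c}, μ P.1.toSet := by
          gcongr
          exact measure_biUnion_le μ hcnt (fun P : Cube d => P.toSet)
      _ = ∑' P : {P ∈ B | col P = c}, (2 * D) * μ P.1.toSet := ENNReal.tsum_mul_left.symm
      _ ≤ ∑' P : {P ∈ B | col P = c}, μ (Cube.scale 10 P.1).toSet :=
          ENNReal.tsum_le_tsum fun P => (not_le.1 P.2.1.2).le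
      _ = μ (⋃ P ∈ {P ∈ B | col P = c}, (Cube.scale 10 P).toSet) := by
          rw [measure_biUnion hcnt]
          · rintro P hP P' hP' hne
            refine disjoint_iff_inter_eq_empty.2 ?_
            by_contra hcon
            exact hne (hcol P hP.1.1 P' hP'.1.1 (hP.2.trans hP'.2.symm)
              (nonempty_iff_ne_empty.2 hcon))
          · exact fun P _ => (isClosed_toSet _).measurableSet
      _ ≤ μ Ω := measure_mono (iUnion₂_subset fun P hP => h10 P hP.1.1)
  have hB2 : 2 * μ (⋃ P ∈ B, P.toSet) ≤ μ Ω := by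
    have : D * (2 * μ (⋃ P ∈ B, P.toSet)) ≤ D * μ Ω := by
      calc D * (2 * μ (⋃ P ∈ B, P.toSet)) = (2 * D) * μ (⋃ P ∈ B, P.toSet) := by ring
        _ ≤ (2 * D) * ∑ c, μ (⋃ P ∈ {P ∈ B | col P = c}, P.toSet) := by
          gcongr; exact hsplit B
        _ = ∑ c, (2 * D) * μ (⋃ P ∈ {P ∈ B | col P = c}, P.toSet) := Finset.mul_sum _ _ _
        _ ≤ ∑ c : κ, μ Ω := Finset.sum_le_sum fun c _ => hBc c
        _ = D * μ Ω := by simp [hD]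
    rwa [ENNReal.mul_le_mul_iff_right hD0 hDt] at this
  have hΩ : μ Ω ≤ μ (⋃ P ∈ G, P.toSet) + μ (⋃ P ∈ B, P.toSet) := by
    refine (measure_mono ?_).trans (measure_union_le _ _)
    rw [← hU]
    refine iUnion₂_subset fun P hP x hx => ?_
    by_cases hg : μ (Cube.scale 10 P).toSet ≤ (2 * D) * μ P.toSet
    · exact Or.inl (mem_iUnion₂.2 ⟨P, ⟨hP, hg⟩, hx⟩)
    · exact Or.inr (mem_iUnion₂.2 ⟨P, ⟨hP, hg⟩, hx⟩)
  have hG2 : μ Ω ≤ 2 * μ (⋃ P ∈ G, P.toSet) := by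
    have : μ Ω + μ Ω ≤ 2 * μ (⋃ P ∈ G, P.toSet) + μ Ω := by
      calc μ Ω + μ Ω = 2 * μ Ω := by ring
        _ ≤ 2 * (μ (⋃ P ∈ G, P.toSet) + μ (⋃ P ∈ B, P.toSet)) := by gcongr
        _ = 2 * μ (⋃ P ∈ G, P.toSet) + 2 * μ (⋃ P ∈ B, P.toSet) := by ring
        _ ≤ _ := by gcongr
    exact (ENNReal.add_le_add_iff_right hμ.ne).1 this
  obtain ⟨c, -, hc⟩ := Finset.exists_max_image Finset.univ
    (fun c => μ (⋃ P ∈ {P ∈ G | col P = c}, P.toSet)) Finset.univ_nonempty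
  refine ⟨{P ∈ G | col P = c}, fun P hP => hP.1.1, fun P hP => hP.1.2, ?_, ?_⟩
  · rintro P hP P' hP' hne
    refine disjoint_iff_inter_eq_empty.2 ?_
    by_contra hcon
    exact hne (hcol P hP.1.1 P' hP'.1.1 (hP.2.trans hP'.2.symm)
      (nonempty_iff_ne_empty.2 hcon))
  · calc μ Ω ≤ 2 * μ (⋃ P ∈ G, P.toSet) := hG2
      _ ≤ 2 * ∑ c, μ (⋃ P ∈ {P ∈ G | col P = c}, P.toSet) := by gcongr; exact hsplit G
      _ ≤ 2 * ∑ _c : κ, μ (⋃ P ∈ {P ∈ G | col P = c}, P.toSet) := by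
          gcongr 2 * ?_
          exact Finset.sum_le_sum fun c' _ => hc c' (Finset.mem_univ _)
      _ = _ := by simp [hD, mul_assoc]

/-- **Whitney decomposition with doubling small-boundary enlargements.**
Every open `Ω ⊊ ℝ^d` decomposes into countably many closed dyadic cubes with disjoint
interiors such that `10Qᵢ ⊆ Ω`, `R·Qᵢ` meets `Ωᶜ`, with `D₀`-bounded overlap of the `10Qᵢ`
and comparable side lengths of overlapping cubes.  Moreover, for any Radon measure `μ` with
`μ(Ω) < ∞` there are pairwise disjoint concentric enlargements `Q̃ⱼ ⊆ 1.1Qⱼ` over a subfamily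
`S`, each `(9, 2D₀)`-doubling with `C₁`-small boundary, capturing `μ(Ω)/(8D₀)` of the mass. -/
theorem whitney_decomposition_small_boundary (d : ℕ) (hd : 0 < d) :
    ∃ (R : ℝ) (D₀ : ℕ) (Acmp C₁ : ℝ), 20 < R ∧ 1 ≤ D₀ ∧ 1 ≤ Acmp ∧ 0 < C₁ ∧
      ∀ Ω : Set (Pt d), IsOpen Ω → Ω ≠ Set.univ →
        ∃ F : Set (Cube d), F.Countable ∧ (∀ P ∈ F, IsDyadicCube P) ∧
          (⋃ P ∈ F, P.toSet) = Ω ∧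
          (∀ P ∈ F, ∀ P' ∈ F, P ≠ P' →
            interior P.toSet ∩ interior P'.toSet = ∅) ∧
          (∀ P ∈ F, (Cube.scale 10 P).toSet ⊆ Ω) ∧
          (∀ P ∈ F, ((Cube.scale R P).toSet ∩ Ωᶜ).Nonempty) ∧
          (∀ P ∈ F,
            {P' | P' ∈ F ∧
              ((Cube.scale 10 P).toSet ∩ (Cube.scale 10 P').toSet).Nonempty}.Finite ∧
            {P' | P' ∈ F ∧
              ((Cube.scale 10 P).toSet ∩ (Cube.scale 10 P').toSet).Nonempty}.ncard ≤ D₀ ∧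
            ∀ P' ∈ F, ((Cube.scale 10 P).toSet ∩ (Cube.scale 10 P').toSet).Nonempty →
              P'.side ≤ Acmp * P.side ∧ P.side ≤ Acmp * P'.side) ∧
          (∀ μ : Measure (Pt d), IsLocallyFiniteMeasure μ → μ Ω < ∞ →
            ∃ (S : Set (Cube d)) (g : Cube d → Cube d), S ⊆ F ∧
              (∀ P ∈ S,
                (g P).center = P.center ∧
                P.toSet ⊆ (g P).toSet ∧ (g P).toSet ⊆ (Cube.scale 1.1 P).toSet ∧
                IsDoubling μ 9 (2 * (D₀ : ℝ)) (g P) ∧ SmallBoundary μ C₁ (g P)) ∧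
              (∀ P ∈ S, ∀ P' ∈ S, P ≠ P' → Disjoint (g P).toSet (g P').toSet) ∧
              μ Ω ≤ (8 * (D₀ : ℝ≥0∞)) * μ (⋃ P ∈ S, (g P).toSet)) := by
  classical
  set κ := ZMod 5 × (Fin d → ZMod 64) with hκ
  refine ⟨43, Fintype.card κ, 6, 500, by norm_num, Fintype.card_pos, by norm_num, by norm_num, ?_⟩
  intro Ω hΩ hne
  obtain ⟨F, hF, hdy, hU, hdis, h20, h43⟩ := whitney_family Ω hΩ hne
  have hpos : ∀ P ∈ F, 0 < P.side := fun P hP => side_pos (hdy P hP)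
  have h10 : ∀ P ∈ F, (Cube.scale 10 P).toSet ⊆ Ω := fun P hP =>
    (scale_mono P (hpos P hP).le (by norm_num) (by norm_num)).trans (h20 P hP)
  have hcmp : ∀ P ∈ F, ∀ P' ∈ F,
      ((Cube.scale 10 P).toSet ∩ (Cube.scale 10 P').toSet).Nonempty →
      P.side ≤ 5.3 * P'.side := fun P hP P' hP' hn =>
    side_cmp P P' (hpos P hP) (hpos P' hP') (h20 P hP) (h43 P' hP') hn
  have hself : ∀ P ∈ F, ((Cube.scale 10 P).toSet ∩ (Cube.scale 10 P).toSet).Nonempty := by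
    intro P hP
    have : P.center ∈ (Cube.scale 10 P).toSet := by
      rw [mem_scale P (hpos P hP).le (by norm_num), sd_self]
      have := hpos P hP
      positivity
    exact ⟨_, this, this⟩
  have hinj : ∀ P₀ ∈ F, ∀ P ∈ F, ∀ P' ∈ F,
      ((Cube.scale 10 P₀).toSet ∩ (Cube.scale 10 P).toSet).Nonempty →
      ((Cube.scale 10 P₀).toSet ∩ (Cube.scale 10 P').toSet).Nonempty →
      col P = col P' → P = P' := by
    intro P₀ h₀ P hP P' hP' hn hn' hc
    exact col_inj P₀ P P' (hpos _ h₀) (hdy P hP) (hdy P' hP') hn hn'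
      (hcmp P hP P₀ h₀ (by rwa [inter_comm])) (hcmp P₀ h₀ P hP hn)
      (hcmp P' hP' P₀ h₀ (by rwa [inter_comm])) (hcmp P₀ h₀ P' hP' hn') hc
  refine ⟨F, hF, hdy, hU, hdis, h10, h43, ?_, ?_⟩
  · intro P hP
    have hio : InjOn (col (d := d)) {P' | P' ∈ F ∧
              ((Cube.scale 10 P).toSet ∩ (Cube.scale 10 P').toSet).Nonempty} := by
      intro P₁ h₁ P₂ h₂ h
      exact hinj P hP P₁ h₁.1 P₂ h₂.1 h₁.2 h₂.2 h
    refine ⟨Set.Finite.of_injOn (mapsTo_univ _ _) hio finite_univ, ?_, ?_⟩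
    · have := Set.ncard_le_ncard_of_injOn (t := (univ : Set κ)) _ (fun _ _ => mem_univ _) hio
        finite_univ
      rwa [ncard_univ, Nat.card_eq_fintype_card] at this
    · intro P' hP' hn
      have h1 := hcmp P hP P' hP' hn
      have h2 := hcmp P' hP' P hP (by rwa [inter_comm])
      have := hpos P hP
      have := hpos P' hP'
      constructor <;> linarith
  · intro μ _ hμ
    obtain ⟨S, hSF, hSd, hSdis, hSm⟩ := mass (col (d := d)) Ω F hF hU h10
      (fun P hP P' hP' hc hn => hinj P hP P hP P' hP' (hself P hP) hn hc) μ hμ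
    have hex : ∀ P : Cube d, ∃ t : ℝ, P ∈ S →
        t ∈ Icc (1 : ℝ) 1.1 ∧ SmallBoundary μ 500 (Cube.scale t P) := by
      intro P
      by_cases hP : P ∈ S
      · obtain ⟨t, ht, h⟩ := exists_small_boundary hd μ P (hpos P (hSF hP))
          ((measure_mono (h10 P (hSF hP))).trans_lt hμ)
        exact ⟨t, fun _ => ⟨ht, h⟩⟩
      · exact ⟨1, fun h => absurd h hP⟩
    choose t ht using hex
    have hsub1 : ∀ P ∈ S, P.toSet ⊆ (Cube.scale (t P) P).toSet := by
      intro P hP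
      conv_lhs => rw [← scale_one_toSet]
      exact scale_mono P (hpos P (hSF hP)).le (by norm_num) (ht P hP).1.1
    have hsub2 : ∀ P ∈ S, (Cube.scale (t P) P).toSet ⊆ (Cube.scale 1.1 P).toSet := by
      intro P hP
      exact scale_mono P (hpos P (hSF hP)).le (by linarith [(ht P hP).1.1]) (ht P hP).1.2
    have hsub3 : ∀ P ∈ S, (Cube.scale (t P) P).toSet ⊆ (Cube.scale 10 P).toSet := by
      intro P hP
      exact (hsub2 P hP).trans
        (scale_mono P (hpos P (hSF hP)).le (by norm_num) (by norm_num))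
    refine ⟨S, fun P => Cube.scale (t P) P, hSF, ?_, ?_, ?_⟩
    · intro P hP
      refine ⟨rfl, hsub1 P hP, hsub2 P hP, ?_, (ht P hP).2⟩
      have h9 : (Cube.scale 9 (Cube.scale (t P) P)).toSet ⊆ (Cube.scale 10 P).toSet := by
        have e : Cube.scale 9 (Cube.scale (t P) P) = Cube.scale (9 * t P) P := by
          simp [Cube.scale, mul_assoc]
        rw [e]
        have h1 := (ht P hP).1.1
        have h2 := (ht P hP).1.2
        exact scale_mono P (hpos P (hSF hP)).le (by linarith) (by norm_num at h2; linarith)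
      have e2 : ENNReal.ofReal (2 * (Fintype.card κ : ℝ)) = 2 * (Fintype.card κ : ℝ≥0∞) := by
        rw [ENNReal.ofReal_mul (by norm_num)]; simp
      unfold IsDoubling
      rw [e2]
      calc _ ≤ μ (Cube.scale 10 P).toSet := measure_mono h9
        _ ≤ _ := hSd P hP
        _ ≤ _ := by gcongr; exact hsub1 P hP
    · intro P hP P' hP' hne'
      exact (hSdis P hP P' hP' hne').mono (hsub3 P hP) (hsub3 P' hP')
    · refine hSm.trans ?_
      gcongr ?_ * μ ?_
      · gcongr; norm_num
      · exact iUnion₂_mono fun P hP => hsub1 P hP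
end
end

section
/- Paraaccretivity stopping estimate: Let μ be a Radon measure on ℝ^d, Q ⊂ ℝ^d a cube, q ∈ (1,∞), and let b be an L^q(μ)-admissible test function on Q with constant B₁. Define the measure σ by σ(A) = ∫_A |b| dμ, write b = |b| b̂ with |b̂| = 1 σ-a.e. (polar decomposition), and set η = (1/2) B₁^{−1/q}. Suppose T ⊂ Q is a countable union of pairwise disjoint Borel sets R_i ⊂ Q such that |∫_{R_i} b̂ dσ| ≤ η σ(R_i) for every i. Then σ(T) ≤ (1 − η) σ(Q). -/
open MeasureTheory Metric Set ENNReal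

noncomputable section

theorem Cube.isCompact_toSet {d : ℕ} (Q : Cube d) : IsCompact Q.toSet := by
  have h : Q.toSet = (EuclideanSpace.equiv (Fin d) ℝ).toHomeomorph ⁻¹'
      (Set.univ.pi fun i => Set.Icc (Q.center i - Q.side / 2) (Q.center i + Q.side / 2)) := by
    ext x
    simp only [Cube.toSet, Set.mem_setOf_eq, Set.mem_preimage, Set.mem_univ_pi, Set.mem_Icc]
    refine forall_congr' fun i => ?_
    rw [abs_le]
    change _ ↔ Q.center i - Q.side / 2 ≤ x i ∧ x i ≤ Q.center i + Q.side / 2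
    constructor <;> rintro ⟨h1, h2⟩ <;> constructor <;> linarith
  rw [h, Homeomorph.isCompact_preimage]
  exact isCompact_univ_pi fun i => isCompact_Icc

theorem holder_aux {d : ℕ} (μ : Measure (Pt d)) (Q : Set (Pt d)) (q B₁ : ℝ) (hq : 1 < q)
    (hB₁ : 0 < B₁) (b : Pt d → ℂ) (hbm : Measurable b)
    (hb : ∫⁻ x in Q, (‖b x‖₊ : ℝ≥0∞) ^ q ∂μ ≤ ENNReal.ofReal B₁ * μ Q) (hfin : μ Q ≠ ⊤) :
    ∫⁻ x in Q, (‖b x‖₊ : ℝ≥0∞) ∂μ ≤ ENNReal.ofReal (B₁ ^ (1 / q)) * μ Q := by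
  have h := eLpNorm'_le_eLpNorm'_mul_rpow_measure_univ (p := 1) (q := q) (μ := μ.restrict Q)
    one_pos hq.le hbm.aestronglyMeasurable
  have hq0 : 0 < q := by linarith
  have hle : 0 ≤ 1 - 1 / q := by
    rw [sub_nonneg, div_le_one hq0]; exact hq.le
  simp only [eLpNorm', ENNReal.rpow_one, div_one, Measure.restrict_apply_univ] at h
  refine h.trans ?_
  calc _ ≤ (ENNReal.ofReal B₁ * μ Q) ^ (1 / q) * μ Q ^ (1 - 1 / q) := by
        gcongr
        exact hb
    _ = ENNReal.ofReal (B₁ ^ (1 / q)) * μ Q := by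
        rw [ENNReal.mul_rpow_of_nonneg _ _ (by positivity), mul_assoc,
          ← ENNReal.rpow_add_of_nonneg _ _ (by positivity) hle,
          ENNReal.ofReal_rpow_of_pos hB₁]
        simp

/-- **Paraaccretivity stopping estimate.**
Let `b` be an `L^q(μ)`-admissible test function on `Q`, `σ = |b| dμ`, and `b = |b| b̂` its
polar decomposition with `|b̂| = 1` `σ`-a.e.  If `T = ∪ᵢ Rᵢ` is a countable union of pairwise
disjoint Borel subsets of `Q` on each of which `|∫_{Rᵢ} b̂ dσ| ≤ η σ(Rᵢ)` with
`η = (1/2) B₁^{−1/q}`, then `σ(T) ≤ (1 − η) σ(Q)`. -/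
theorem paraaccretivity_stopping_estimate (d : ℕ) (μ : Measure (Pt d))
    [IsLocallyFiniteMeasure μ] (Q : Cube d) (q B₁ : ℝ) (hq : 1 < q) (hB₁ : 0 < B₁)
    (b : Pt d → ℂ) (hbm : Measurable b) (hb : IsAdmissible μ Q q B₁ b)
    (bhat : Pt d → ℂ)
    (σ : Measure (Pt d)) (hσ : σ = μ.withDensity fun x => (‖b x‖₊ : ℝ≥0∞))
    (hpolar : ∀ x, b x = (‖b x‖ : ℂ) * bhat x)
    (hunim : ∀ᵐ x ∂σ, ‖bhat x‖ = 1)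
    (η : ℝ) (hη : η = (1 / 2) * B₁ ^ (-(1 / q)))
    (R : ℕ → Set (Pt d)) (hRmeas : ∀ i, MeasurableSet (R i))
    (hRsub : ∀ i, R i ⊆ Q.toSet)
    (hRdisj : Pairwise (Function.onFun Disjoint R))
    (hRsmall : ∀ i, ‖∫ x in R i, bhat x ∂σ‖ ≤ η * (σ (R i)).toReal)
    (T : Set (Pt d)) (hT : T = ⋃ i, R i) :
    σ T ≤ ENNReal.ofReal (1 - η) * σ Q.toSet := by
  have hQc := Q.isCompact_toSet
  have hQm : MeasurableSet Q.toSet := hQc.measurableSet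
  have hfin : μ Q.toSet ≠ ⊤ := hQc.measure_lt_top.ne
  obtain ⟨-, hint, hLq⟩ := hb
  have hH := holder_aux μ Q.toSet q B₁ hq hB₁ b hbm hLq hfin
  have hσA : ∀ A, MeasurableSet A → σ A = ∫⁻ x in A, (‖b x‖₊ : ℝ≥0∞) ∂μ := by
    intro A hA
    rw [hσ, withDensity_apply _ hA]
  have hσQ : σ Q.toSet ≠ ⊤ := by
    rw [hσA _ hQm]
    exact (hH.trans_lt (ENNReal.mul_lt_top ENNReal.ofReal_lt_top hfin.lt_top)).ne
  have hbint : IntegrableOn b Q.toSet μ := by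
    refine ⟨hbm.aestronglyMeasurable, ?_⟩
    rw [hσA _ hQm] at hσQ
    exact hσQ.lt_top
  have hTm : MeasurableSet T := hT ▸ MeasurableSet.iUnion hRmeas
  have hTQ : T ⊆ Q.toSet := hT ▸ Set.iUnion_subset hRsub
  have hs : ∀ A, MeasurableSet A → (∫ x in A, ‖b x‖ ∂μ) = (σ A).toReal := by
    intro A hA
    rw [hσA A hA, integral_norm_eq_lintegral_enorm hbm.aestronglyMeasurable]
    rfl
  have hhat : ∀ A, MeasurableSet A → ∫ x in A, bhat x ∂σ = ∫ x in A, b x ∂μ := by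
    intro A hA
    rw [hσ, setIntegral_withDensity_eq_setIntegral_smul hbm.nnnorm _ hA]
    refine integral_congr_ae (Filter.Eventually.of_forall fun x => ?_)
    change ((‖b x‖₊ : NNReal) • bhat x) = b x
    conv_rhs => rw [hpolar x]
    rw [NNReal.smul_def]
    simp
  have hsumb : HasSum (fun i => ∫ x in R i, b x ∂μ) (∫ x in T, b x ∂μ) := by
    rw [hT]
    exact hasSum_integral_iUnion hRmeas hRdisj (hT ▸ hbint.mono_set hTQ)
  have hsums : HasSum (fun i => ∫ x in R i, ‖b x‖ ∂μ) (∫ x in T, ‖b x‖ ∂μ) := by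
    rw [hT]
    exact hasSum_integral_iUnion hRmeas hRdisj (hT ▸ (hbint.mono_set hTQ).norm)
  have hTb : ‖∫ x in T, b x ∂μ‖ ≤ η * (σ T).toReal := by
    rw [← hs T hTm, ← hsumb.tsum_eq]
    refine tsum_of_norm_bounded (hsums.mul_left η) fun i => ?_
    rw [hs _ (hRmeas i), ← hhat _ (hRmeas i)]
    exact hRsmall i
  have hdiff : ‖∫ x in Q.toSet \ T, b x ∂μ‖ ≤ (σ Q.toSet).toReal - (σ T).toReal := by
    refine (norm_integral_le_integral_norm _).trans_eq ?_
    rw [integral_diff hTm hbint.norm hTQ, hs _ hQm, hs _ hTm]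
  have hsplit : ∫ x in Q.toSet \ T, b x ∂μ
      = ((μ Q.toSet).toReal : ℂ) - ∫ x in T, b x ∂μ := by
    rw [integral_diff hTm hbint hTQ, hint]
  have hm : (μ Q.toSet).toReal ≤ η * (σ T).toReal + ((σ Q.toSet).toReal - (σ T).toReal) := by
    have h1 : ((μ Q.toSet).toReal : ℂ)
        = (∫ x in T, b x ∂μ) + ∫ x in Q.toSet \ T, b x ∂μ := by rw [hsplit]; ring
    have h2 : ‖((μ Q.toSet).toReal : ℂ)‖ = (μ Q.toSet).toReal := by simp
    rw [← h2, h1]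
    exact (norm_add_le _ _).trans (add_le_add hTb hdiff)
  have hηpos : 0 < η := by rw [hη]; positivity
  have hσT : σ T ≠ ⊤ := ((measure_mono hTQ).trans_lt hσQ.lt_top).ne
  have hTle : (σ T).toReal ≤ (σ Q.toSet).toReal := ENNReal.toReal_mono hσQ (measure_mono hTQ)
  have hHr : 2 * η * (σ Q.toSet).toReal ≤ (μ Q.toSet).toReal := by
    have h1 : (σ Q.toSet).toReal ≤ B₁ ^ (1 / q) * (μ Q.toSet).toReal := by
      rw [hσA _ hQm]
      have := ENNReal.toReal_mono (ENNReal.mul_ne_top ENNReal.ofReal_ne_top hfin) hH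
      rwa [ENNReal.toReal_mul, ENNReal.toReal_ofReal (by positivity)] at this
    have h2 : 2 * η * B₁ ^ (1 / q) = 1 := by
      rw [hη, Real.rpow_neg hB₁.le]
      have : B₁ ^ (1 / q) ≠ 0 := by positivity
      field_simp
    calc 2 * η * (σ Q.toSet).toReal ≤ 2 * η * (B₁ ^ (1 / q) * (μ Q.toSet).toReal) := by gcongr
      _ = (μ Q.toSet).toReal := by rw [← mul_assoc, h2, one_mul]
  have hmle : (μ Q.toSet).toReal ≤ (σ Q.toSet).toReal := by
    have h2 : ‖((μ Q.toSet).toReal : ℂ)‖ = (μ Q.toSet).toReal := by simp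
    rw [← h2, ← hint, ← hs _ hQm]
    exact norm_integral_le_integral_norm _
  rcases eq_or_ne (σ Q.toSet) 0 with h0 | h0
  · rw [h0, mul_zero]
    exact (measure_mono hTQ).trans h0.le
  have hpos : 0 < (σ Q.toSet).toReal := ENNReal.toReal_pos h0 hσQ
  have hη2 : 2 * η ≤ 1 := by
    by_contra! hc
    nlinarith
  have key : (σ T).toReal ≤ (1 - η) * (σ Q.toSet).toReal := by
    have h1 : (1 - η) * (σ T).toReal ≤ (1 - η) * ((1 - η) * (σ Q.toSet).toReal) := by
      nlinarith [mul_nonneg (sq_nonneg η) hpos.le]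
    exact le_of_mul_le_mul_left h1 (by linarith)
  rw [← ENNReal.toReal_le_toReal hσT (ENNReal.mul_ne_top ENNReal.ofReal_ne_top hσQ),
    ENNReal.toReal_mul, ENNReal.toReal_ofReal (by linarith)]
  exact key
end
end

section
/- Dyadic boundary quadratic sum estimate (term B): Let μ be a Radon measure on ℝ^d of degree n ∈ (0,d] with constant C₀, let p ∈ (1,2] with dual exponent p', t > 0, and let f ∈ L^p_loc(μ). Let R ⊂ ℝ^d be a cube which has t-small boundary with respect to the measure σ_p defined by σ_p(A) = ∫_A |f|^p dμ, and let 0 < u < 2/p + 2n/p' − n. Then Σ_{P ∈ 𝒟(R), 5P ∩ ∂R ≠ ∅} ( ∫_{5P} |f| dμ )² ℓ(P)^{−n} (ℓ(R)/ℓ(P))^u ≤ C(C₀, n, p, u, t, d) · ℓ(R)^{2n/p' − n} ( ∫_{5R} |f|^p dμ )^{2/p}, where 𝒟(R) = ∪_{j≥0} 𝒟_j(R) and 𝒟_j(R) is the partition of R into 2^{jd} congruent subcubes of side length 2^{−j} ℓ(R). -/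
open MeasureTheory Metric Set ENNReal

noncomputable section

lemma sum_rpow_le_aux {ι : Type*} (s : Finset ι) (a : ι → ℝ≥0∞) (r : ℝ) (hr : 1 ≤ r) :
    ∑ i ∈ s, a i ^ r ≤ (∑ i ∈ s, a i) ^ r := by
  classical
  induction s using Finset.induction_on with
  | empty => simp
  | insert i s hi ih =>
    rw [Finset.sum_insert hi, Finset.sum_insert hi]
    exact (add_le_add le_rfl ih).trans (ENNReal.add_rpow_le_rpow_add _ _ hr)

lemma card_aux (N : ℕ) (a : ℝ) :
    (Finset.univ.filter (fun k : Fin N => |(k : ℝ) - a| ≤ 5 / 2)).card ≤ 6 := by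
  have h : (Finset.univ.filter (fun k : Fin N => |(k : ℝ) - a| ≤ 5 / 2)).card ≤
      (Finset.Icc ⌈a - 5/2⌉ (⌈a - 5/2⌉ + 5)).card := by
    apply Finset.card_le_card_of_injOn (fun k : Fin N => ((k : ℕ) : ℤ))
    · intro k hk
      simp only [Finset.coe_filter, Finset.mem_univ, true_and, Set.mem_ofPred_eq] at hk
      rw [abs_le] at hk
      simp only [Finset.coe_Icc, Set.mem_Icc]
      constructor
      · apply Int.ceil_le.2
        push_cast
        linarith
      · have h1 := Int.le_ceil (a - 5/2)
        have : (((k : ℕ) : ℤ) : ℝ) ≤ ((⌈a - 5/2⌉ + 5 : ℤ) : ℝ) := by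
          push_cast
          linarith
        exact_mod_cast this
    · intro k _ l _ h
      simpa [Fin.ext_iff] using h
  refine h.trans (le_of_eq ?_)
  rw [Int.card_Icc]
  omega

lemma dist_aux {d : ℕ} (hd : 0 < d) (x y : Pt d) (M : ℝ) (hM : 0 ≤ M)
    (h : ∀ i, |x i - y i| ≤ M) : dist x y ≤ d * M := by
  rw [EuclideanSpace.dist_eq]
  apply Real.sqrt_le_iff.2
  refine ⟨by positivity, ?_⟩
  have h1 : ∑ i, dist (x i) (y i) ^ 2 ≤ ∑ i : Fin d, M ^ 2 := by
    apply Finset.sum_le_sum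
    intro i _
    rw [Real.dist_eq]
    exact pow_le_pow_left₀ (abs_nonneg _) (h i) 2
  have h2 : (1 : ℝ) ≤ d := by exact_mod_cast hd
  simp at h1
  nlinarith [sq_nonneg M, mul_nonneg (sub_nonneg.2 h2) (mul_nonneg (by linarith : (0:ℝ) ≤ d) (sq_nonneg M))]

lemma measurable_cube {d : ℕ} (Q : Cube d) : MeasurableSet Q.toSet := by
  have : Q.toSet = ⋂ i, {x : Pt d | |x i - Q.center i| ≤ Q.side / 2} := by
    ext x; simp [Cube.toSet]
  rw [this]
  exact MeasurableSet.iInter fun i =>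
    (isClosed_le (by fun_prop) (by fun_prop)).measurableSet

lemma overlap_aux {d : ℕ} (R : Cube d) (hR : 0 < R.side) (j : ℕ) (x : Pt d) :
    (∑ m : Fin d → Fin (2 ^ j),
      (Cube.scale 5 (R.dyadicPiece j m)).toSet.indicator (fun _ => (1 : ℝ≥0∞)) x) ≤ 6 ^ d := by
  classical
  simp only [Set.indicator_apply]
  rw [← Finset.sum_filter, Finset.sum_const, nsmul_eq_mul, mul_one]
  have hl : 0 < R.side / 2 ^ j := by positivity
  have : (Finset.univ.filter (fun m : Fin d → Fin (2 ^ j) =>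
      x ∈ (Cube.scale 5 (R.dyadicPiece j m)).toSet)).card ≤ 6 ^ d := by
    calc _ ≤ (Fintype.piFinset (fun i : Fin d => Finset.univ.filter (fun k : Fin (2 ^ j) =>
            |(k : ℝ) - ((x i - (R.center i - R.side / 2)) / (R.side / 2 ^ j) - 1 / 2)| ≤ 5 / 2))).card := by
          apply Finset.card_le_card
          intro m hm
          simp only [Finset.mem_filter, Finset.mem_univ, true_and, Fintype.mem_piFinset] at hm ⊢
          intro i
          have h := hm i
          simp only [Cube.scale, Cube.dyadicPiece, WithLp.equiv_symm_apply] at h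
          set l := R.side / 2 ^ j
          have e : x i - (R.center i - R.side / 2 + l * ((m i : ℝ) + 1 / 2)) =
            - (l * ((m i : ℝ) - ((x i - (R.center i - R.side / 2)) / l - 1 / 2))) := by
            field_simp; ring
          rw [e, abs_neg, abs_mul, abs_of_pos hl] at h
          nlinarith
      _ ≤ 6 ^ d := by
          rw [Fintype.card_piFinset]
          calc _ ≤ ∏ i : Fin d, 6 := Finset.prod_le_prod' fun i _ => card_aux _ _
            _ = _ := by simp
  exact_mod_cast this

lemma sub_aux {d : ℕ} (R : Cube d) (hR : 0 < R.side) (j : ℕ) (m : Fin d → Fin (2 ^ j)) :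
    (Cube.scale 5 (R.dyadicPiece j m)).toSet ⊆ (Cube.scale 5 R).toSet := by
  intro x hx i
  have h := hx i
  simp only [Cube.scale, Cube.dyadicPiece, WithLp.equiv_symm_apply] at h ⊢
  have hl : 0 < R.side / 2 ^ j := by positivity
  have hs : R.side = (R.side / 2 ^ j) * 2 ^ j := by field_simp
  set l := R.side / 2 ^ j
  have h1 : (m i : ℝ) + 1 ≤ 2 ^ j := by
    have := (m i).2
    exact_mod_cast this
  have h0 : (0 : ℝ) ≤ (m i : ℝ) := by positivity
  have h2 : l * ((m i : ℝ) + 1) ≤ R.side := by rw [hs]; gcongr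
  have h3 : 0 ≤ l * (m i : ℝ) := by positivity
  rw [abs_le] at h ⊢
  constructor <;> nlinarith

lemma holder_aux_s18 {d : ℕ} (μ : Measure (Pt d)) (f : Pt d → ℂ) (hf : Measurable f) (p p' : ℝ)
    (hpq : p.HolderConjugate p') (A : Set (Pt d)) :
    (∫⁻ x in A, (‖f x‖₊ : ℝ≥0∞) ∂μ) ^ (2 : ℕ) ≤
      (∫⁻ x in A, (‖f x‖₊ : ℝ≥0∞) ^ p ∂μ) ^ (2 / p) * (μ A) ^ (2 / p') := by
  have h := ENNReal.lintegral_mul_le_Lp_mul_Lq (μ.restrict A) hpq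
    (f := fun x => (‖f x‖₊ : ℝ≥0∞)) (g := fun _ => 1) (by fun_prop) (by fun_prop)
  simp only [Pi.mul_apply, mul_one, ENNReal.one_rpow, lintegral_one, Measure.restrict_apply_univ] at h
  refine (pow_le_pow_left₀ (by positivity) h 2).trans (le_of_eq ?_)
  rw [mul_pow, ← ENNReal.rpow_natCast, ← ENNReal.rpow_natCast, ← ENNReal.rpow_mul, ← ENNReal.rpow_mul]
  congr 2 <;> push_cast <;> ring

lemma meas_aux {d : ℕ} (hd : 0 < d) (μ : Measure (Pt d)) (n C₀ : ℝ) (h : HasDegree μ n C₀)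
    (Q : Cube d) (hQ : 0 < Q.side) :
    μ (Cube.scale 5 Q).toSet ≤ ENNReal.ofReal (C₀ * (5 * d * Q.side) ^ n) := by
  refine (measure_mono ?_).trans (h Q.center (5 * d * Q.side) (by positivity))
  intro x hx
  rw [mem_ball]
  have := dist_aux hd x Q.center (5 * Q.side / 2) (by positivity) hx
  have : 0 < (d : ℝ) * Q.side := by positivity
  linarith

open Classical in
lemma level_aux {d : ℕ} (hd : 0 < d) (μ : Measure (Pt d)) (g : Pt d → ℝ≥0∞) (hg : Measurable g)
    (t : ℝ) (ht : 0 < t) (R : Cube d) (hR : 0 < R.side)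
    (hsb : SmallBoundary (μ.withDensity g) t R) (j : ℕ) :
    (∑ m : Fin d → Fin (2 ^ j),
      if ((Cube.scale 5 (R.dyadicPiece j m)).toSet ∩ frontier R.toSet).Nonempty then
        ∫⁻ x in (Cube.scale 5 (R.dyadicPiece j m)).toSet, g x ∂μ else 0) ≤
      ENNReal.ofReal (6 ^ d * (t * (5 * d / 2 ^ j))) * ∫⁻ x in (Cube.scale 5 R).toSet, g x ∂μ := by
  have hd' : (0 : ℝ) < d := by exact_mod_cast hd
  have hl : 0 < R.side / 2 ^ j := by positivity
  set S := {x ∈ (Cube.scale 5 R).toSet | infDist x (frontier R.toSet) ≤ (5 * d / 2 ^ j) * R.side} with hS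
  have hSm : MeasurableSet S := (measurable_cube _).inter
    (isClosed_le (continuous_infDist_pt _) continuous_const).measurableSet
  have h1 := hsb (5 * d / 2 ^ j) (by positivity)
  rw [← hS, withDensity_apply _ hSm, withDensity_apply _ (measurable_cube _)] at h1
  have h2 : ∀ m : Fin d → Fin (2 ^ j),
      (if ((Cube.scale 5 (R.dyadicPiece j m)).toSet ∩ frontier R.toSet).Nonempty then
        ∫⁻ x in (Cube.scale 5 (R.dyadicPiece j m)).toSet, g x ∂μ else 0) ≤
      ∫⁻ x in S, g x * (Cube.scale 5 (R.dyadicPiece j m)).toSet.indicator (fun _ => 1) x ∂μ := by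
    intro m
    split_ifs with hc
    · obtain ⟨y, hy, hyR⟩ := hc
      have hsub : (Cube.scale 5 (R.dyadicPiece j m)).toSet ⊆ S := by
        intro x hx
        refine ⟨sub_aux R hR j m hx, (infDist_le_dist_of_mem hyR).trans ?_⟩
        have := dist_aux hd x y (5 * (R.side / 2 ^ j)) (by positivity) (by
          intro i
          have a := hx i
          have b := hy i
          simp only [Cube.scale, Cube.dyadicPiece, WithLp.equiv_symm_apply] at a b
          rw [abs_le] at a b ⊢
          constructor <;> linarith [a.1, a.2, b.1, b.2])
        refine this.trans (le_of_eq (by ring))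
      rw [← lintegral_indicator (measurable_cube _), ← lintegral_indicator hSm]
      apply lintegral_mono
      intro x
      by_cases hx : x ∈ (Cube.scale 5 (R.dyadicPiece j m)).toSet
      · simp [hx, hsub hx]
      · simp [hx]
    · exact zero_le
  calc _ ≤ ∑ m : Fin d → Fin (2 ^ j), ∫⁻ x in S, g x * (Cube.scale 5 (R.dyadicPiece j m)).toSet.indicator (fun _ => 1) x ∂μ :=
        Finset.sum_le_sum fun m _ => h2 m
    _ = ∫⁻ x in S, ∑ m : Fin d → Fin (2 ^ j), g x * (Cube.scale 5 (R.dyadicPiece j m)).toSet.indicator (fun _ => 1) x ∂μ := by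
        rw [lintegral_finsetSum]
        intro m _
        exact hg.mul (measurable_const.indicator (measurable_cube _))
    _ ≤ ∫⁻ x in S, 6 ^ d * g x ∂μ := by
        apply lintegral_mono
        intro x
        simp only
        rw [← Finset.mul_sum, mul_comm]
        gcongr
        exact overlap_aux R hR j x
    _ = 6 ^ d * ∫⁻ x in S, g x ∂μ := lintegral_const_mul _ hg
    _ ≤ 6 ^ d * (ENNReal.ofReal (t * (5 * d / 2 ^ j)) * ∫⁻ x in (Cube.scale 5 R).toSet, g x ∂μ) := by
        gcongr
    _ = _ := by
        rw [ENNReal.ofReal_mul (p := (6 : ℝ) ^ d) (by positivity), ← mul_assoc,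
          ENNReal.ofReal_pow (by norm_num)]
        simp

lemma real_aux (D c n C₀ p p' t u s : ℝ) (j : ℕ) (hD : 0 < D) (hc : 0 < c) (ht : 0 < t)
    (hC₀ : 0 < C₀) (hs : 0 < s) :
    (c * (t * (D / 2 ^ j))) ^ (2 / p) * ((C₀ * (D * (s / 2 ^ j)) ^ n) ^ (2 / p') *
      ((s / 2 ^ j) ^ (-n) * (s / (s / 2 ^ j)) ^ u)) =
    ((c * (t * D)) ^ (2 / p) * (C₀ * D ^ n) ^ (2 / p')) * s ^ (2 * n / p' - n) *
      ((2 : ℝ) ^ (u - (2 / p + 2 * n / p' - n))) ^ j := by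
  have e0 : s / (s / 2 ^ j) = (2 : ℝ) ^ j := by field_simp
  have e1 : c * (t * (D / 2 ^ j)) = (c * (t * D)) * ((2 : ℝ) ^ j)⁻¹ := by field_simp
  have e2 : C₀ * (D * (s / 2 ^ j)) ^ n = (C₀ * D ^ n) * (s ^ n * (((2 : ℝ) ^ j)⁻¹) ^ n) := by
    rw [div_eq_mul_inv, Real.mul_rpow hD.le (by positivity), Real.mul_rpow hs.le (by positivity)]
    ring
  have hi : (0 : ℝ) < ((2 : ℝ) ^ j)⁻¹ := by positivity
  have hX : 0 < c * (t * D) := by positivity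
  have hY : 0 < C₀ * D ^ n := by positivity
  have hZ : 0 < s ^ n := by positivity
  have hV : 0 < (((2 : ℝ) ^ j)⁻¹) ^ n := by positivity
  rw [e0, e1, e2, div_eq_mul_inv s, Real.mul_rpow hX.le hi.le,
    Real.mul_rpow hY.le (mul_pos hZ hV).le, Real.mul_rpow hZ.le hV.le, Real.mul_rpow hs.le hi.le,
    ← Real.rpow_natCast 2 j, ← Real.rpow_neg (by norm_num), ← Real.rpow_natCast _ j]
  simp only [← Real.rpow_mul (by norm_num : (0:ℝ) ≤ 2), ← Real.rpow_mul hs.le]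
  have e3 : s ^ (2 * n / p' - n) = s ^ (n * (2 / p')) * s ^ (-n) := by
    rw [← Real.rpow_add hs]; congr 1; ring
  have e4 : (2 : ℝ) ^ ((u - (2 / p + 2 * n / p' - n)) * j) =
      2 ^ (-(j : ℝ) * (2 / p)) * 2 ^ (-(j : ℝ) * n * (2 / p')) * 2 ^ (-(j : ℝ) * -n) * 2 ^ (j * u) := by
    rw [← Real.rpow_add (by norm_num), ← Real.rpow_add (by norm_num), ← Real.rpow_add (by norm_num)]
    congr 1; ring
  rw [e3, e4]
  ring

open Classical in
/-- **Dyadic boundary quadratic sum estimate (term B).**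
For `μ` of degree `n`, `p ∈ (1,2]` with dual `p'`, `f ∈ Lᵖ_loc(μ)`, a cube `R` with
`t`-small boundary with respect to `σ_p = |f|^p dμ`, and `0 < u < 2/p + 2n/p' − n`:
`Σ_{P ∈ 𝒟(R), 5P ∩ ∂R ≠ ∅} (∫_{5P} |f| dμ)² ℓ(P)^{−n} (ℓ(R)/ℓ(P))^u
  ≤ C(C₀,n,p,u,t,d) ℓ(R)^{2n/p' − n} (∫_{5R} |f|^p dμ)^{2/p}`. -/
theorem dyadic_boundary_quadratic_sum_B (d : ℕ) (hd : 0 < d) (n C₀ p p' t u : ℝ)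
    (hn : 0 < n) (hnd : n ≤ d) (hC₀ : 0 < C₀) (hp : 1 < p) (hp2 : p ≤ 2)
    (hp' : 1 / p + 1 / p' = 1) (ht : 0 < t)
    (hu0 : 0 < u) (hu : u < 2 / p + 2 * n / p' - n) :
    ∃ Cc : ℝ, 0 < Cc ∧
      ∀ μ : Measure (Pt d), HasDegree μ n C₀ →
      ∀ f : Pt d → ℂ, Measurable f →
        (∀ x : Pt d, ∀ r : ℝ, 0 < r → ∫⁻ y in ball x r, (‖f y‖₊ : ℝ≥0∞) ^ p ∂μ < ∞) →
      ∀ R : Cube d, 0 < R.side →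
        SmallBoundary (μ.withDensity fun x => (‖f x‖₊ : ℝ≥0∞) ^ p) t R →
        (∑' j : ℕ, ∑ m : Fin d → Fin (2 ^ j),
            if ((Cube.scale 5 (R.dyadicPiece j m)).toSet ∩ frontier R.toSet).Nonempty then
              (∫⁻ x in (Cube.scale 5 (R.dyadicPiece j m)).toSet, (‖f x‖₊ : ℝ≥0∞) ∂μ) ^ (2 : ℕ) *
                ENNReal.ofReal ((R.dyadicPiece j m).side ^ (-n) *
                  (R.side / (R.dyadicPiece j m).side) ^ u)
            else 0)
          ≤ ENNReal.ofReal (Cc * R.side ^ (2 * n / p' - n)) *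
              (∫⁻ x in (Cube.scale 5 R).toSet, (‖f x‖₊ : ℝ≥0∞) ^ p ∂μ) ^ (2 / p) := by
  have hp'0 : 0 < p' := by
    have h1 : 1 / p < 1 := by rw [div_lt_one (by linarith)]; exact hp
    have h2 : 0 < 1 / p' := by linarith
    exact one_div_pos.1 h2
  have hp0 : 0 < p := by linarith
  have hpq : p.HolderConjugate p' := by
    rw [Real.holderConjugate_iff]
    exact ⟨hp, by simpa using hp'⟩
  have hd' : (0 : ℝ) < d := by exact_mod_cast hd
  set q : ℝ := (2 : ℝ) ^ (u - (2 / p + 2 * n / p' - n)) with hq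
  have hq0 : 0 < q := by positivity
  have hq1 : q < 1 := Real.rpow_lt_one_of_one_lt_of_neg (by norm_num) (by linarith)
  have hq2 : 0 < 1 - q := by linarith
  set K : ℝ := (6 ^ d * (t * (5 * d))) ^ (2 / p) * (C₀ * (5 * d) ^ n) ^ (2 / p') with hK
  have hK0 : 0 < K := by positivity
  refine ⟨K * (1 - q)⁻¹, by positivity, ?_⟩
  intro μ hμ f hf _ R hR hsb
  set I := ∫⁻ x in (Cube.scale 5 R).toSet, (‖f x‖₊ : ℝ≥0∞) ^ p ∂μ with hI
  have hs0 : 0 < R.side ^ (2 * n / p' - n) := by positivity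
  have hr : 1 ≤ 2 / p := by rw [le_div_iff₀ hp0]; linarith
  have key : ∀ j : ℕ, (∑ m : Fin d → Fin (2 ^ j),
            if ((Cube.scale 5 (R.dyadicPiece j m)).toSet ∩ frontier R.toSet).Nonempty then
              (∫⁻ x in (Cube.scale 5 (R.dyadicPiece j m)).toSet, (‖f x‖₊ : ℝ≥0∞) ∂μ) ^ (2 : ℕ) *
                ENNReal.ofReal ((R.dyadicPiece j m).side ^ (-n) *
                  (R.side / (R.dyadicPiece j m).side) ^ u)
            else 0) ≤ ENNReal.ofReal (K * R.side ^ (2 * n / p' - n)) * I ^ (2 / p) *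
              (ENNReal.ofReal q) ^ j := by
    intro j
    have hl : 0 < R.side / 2 ^ j := by positivity
    set W : ℝ := (C₀ * (5 * d * (R.side / 2 ^ j)) ^ n) ^ (2 / p') *
      ((R.side / 2 ^ j) ^ (-n) * (R.side / (R.side / 2 ^ j)) ^ u) with hW
    have hlev := level_aux hd μ (fun x => (‖f x‖₊ : ℝ≥0∞) ^ p) (by fun_prop) t ht R hR hsb j
    calc _ ≤ ∑ m : Fin d → Fin (2 ^ j),
          (if ((Cube.scale 5 (R.dyadicPiece j m)).toSet ∩ frontier R.toSet).Nonempty then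
            ∫⁻ x in (Cube.scale 5 (R.dyadicPiece j m)).toSet, (‖f x‖₊ : ℝ≥0∞) ^ p ∂μ else 0) ^ (2 / p)
            * ENNReal.ofReal W := by
          apply Finset.sum_le_sum
          intro m _
          split_ifs with hc
          · have h1 := holder_aux_s18 μ f hf p p' hpq (Cube.scale 5 (R.dyadicPiece j m)).toSet
            have h2 := meas_aux hd μ n C₀ hμ (R.dyadicPiece j m) hl
            have h3 : (μ (Cube.scale 5 (R.dyadicPiece j m)).toSet) ^ (2 / p') ≤
                ENNReal.ofReal ((C₀ * (5 * d * (R.side / 2 ^ j)) ^ n) ^ (2 / p')) := by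
              rw [← ENNReal.ofReal_rpow_of_nonneg (by positivity) (by positivity)]
              exact ENNReal.rpow_le_rpow h2 (by positivity)
            refine (mul_le_mul' (h1.trans (mul_le_mul' le_rfl h3)) le_rfl).trans (le_of_eq ?_)
            rw [mul_assoc, ← ENNReal.ofReal_mul (by positivity)]
            rfl
          · exact zero_le
      _ ≤ (ENNReal.ofReal (6 ^ d * (t * (5 * d / 2 ^ j))) * I) ^ (2 / p) * ENNReal.ofReal W := by
          rw [← Finset.sum_mul]
          refine mul_le_mul' ((sum_rpow_le_aux _ _ _ hr).trans ?_) le_rfl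
          exact ENNReal.rpow_le_rpow hlev (by positivity)
      _ = _ := by
          have hra := real_aux (5 * d) (6 ^ d) n C₀ p p' t u R.side j (by positivity)
            (by positivity) ht hC₀ hR
          rw [ENNReal.mul_rpow_of_nonneg _ _ (by positivity),
            ENNReal.ofReal_rpow_of_nonneg (by positivity) (by positivity), mul_right_comm,
            ← ENNReal.ofReal_mul (by positivity), hW, hra, ENNReal.ofReal_mul (by positivity),
            ENNReal.ofReal_pow hq0.le, mul_right_comm]
  refine (ENNReal.tsum_le_tsum key).trans (le_of_eq ?_)
  rw [ENNReal.tsum_mul_left, ENNReal.tsum_geometric, ← ENNReal.ofReal_one,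
    ← ENNReal.ofReal_sub _ hq0.le, ← ENNReal.ofReal_inv_of_pos hq2, mul_right_comm,
    ← ENNReal.ofReal_mul (by positivity)]
  congr 2
  ring
end
end
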